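/- arXiv:1706.06086 — 4 statements merged into one kernel-verified Lean document; each statement's English description precedes it below -/
import Mathlib

section
/- For every integer k ≥ 3 there exists a k-terminal network (G,c), i.e., a finite graph with positive real edge costs and a distinguished set Q of k terminal vertices, such that every mimicking network (G',c') for (G,c) has at least 2^(k−2) edges. (In the paper the witness graph G is moreover planar; the existence claim stated here is what the construction yields without invoking planarity.) -/
open scoped Classical

/-- A `k`-terminal network: a finite graph with real edge costs and an injective
labelling of `k` terminal vertices. -/
structure Network (k : ℕ) : Type 1 where
  V : Type
  [fintypeV : Fintype V]
  [decEqV : DecidableEq V]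
  edges : Finset (Sym2 V)
  cost : Sym2 V → ℝ
  term : Fin k → V
  term_inj : Function.Injective term

attribute [instance] Network.fintypeV Network.decEqV

namespace Network

variable {k : ℕ}

/-- All edge costs are positive reals. -/
def PosCosts (N : Network k) : Prop := ∀ e ∈ N.edges, 0 < N.cost e

/-- The vertex set `A` realizes the terminal partition `S ⊎ Sᶜ`:
terminals indexed by `S` are in `A` and the other terminals are outside `A`. -/
def Separates (N : Network k) (S : Finset (Fin k)) (A : Finset N.V) : Prop :=
  ∀ i : Fin k, N.term i ∈ A ↔ i ∈ S

/-- The set of edges crossing the vertex bipartition `(A, V ∖ A)`. -/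
noncomputable def cutset (N : Network k) (A : Finset N.V) : Finset (Sym2 N.V) :=
  N.edges.filter (fun e => (∃ u ∈ e, u ∈ A) ∧ (∃ v ∈ e, v ∉ A))

/-- The total cost of the edges crossing the bipartition `(A, V ∖ A)`. -/
noncomputable def cutWeight (N : Network k) (A : Finset N.V) : ℝ :=
  ∑ e ∈ N.cutset A, N.cost e

/-- The minimum weight of an `S`-separating cut. -/
noncomputable def mincut (N : Network k) (S : Finset (Fin k)) : ℝ :=
  sInf {w : ℝ | ∃ A : Finset N.V, N.Separates S A ∧ N.cutWeight A = w}

/-- `N'` is a mimicking network for `N`: for every partition of the terminals,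
the minimum separating cuts in `N'` and `N` have equal weight. -/
def IsMimicking (N' N : Network k) : Prop :=
  ∀ S : Finset (Fin k), N'.mincut S = N.mincut S

end Network

namespace Network

variable {k : ℕ}

lemma exists_separates (N : Network k) (S : Finset (Fin k)) :
    ∃ A : Finset N.V, N.Separates S A :=
  ⟨S.image N.term, fun i => by
    rw [Finset.mem_image]
    exact ⟨fun ⟨_, hj, h⟩ => N.term_inj h ▸ hj, fun h => ⟨i, h, rfl⟩⟩⟩

lemma isLeast_mincut (N : Network k) (S : Finset (Fin k)) :
    IsLeast {w : ℝ | ∃ A : Finset N.V, N.Separates S A ∧ N.cutWeight A = w} (N.mincut S) := by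
  have hfin : {w : ℝ | ∃ A : Finset N.V, N.Separates S A ∧ N.cutWeight A = w}.Finite :=
    (Set.finite_range N.cutWeight).subset fun w ⟨A, _, h⟩ => ⟨A, h⟩
  obtain ⟨A, hA⟩ := N.exists_separates S
  have hne : {w : ℝ | ∃ A : Finset N.V, N.Separates S A ∧ N.cutWeight A = w}.Nonempty :=
    ⟨_, A, hA, rfl⟩
  exact ⟨hne.csInf_mem hfin, fun w hw => csInf_le hfin.bddBelow hw⟩

lemma cutWeight_of_edges_eq_map {α : Type*} (N : Network k) {s : Finset α} {f : α ↪ Sym2 N.V}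
    (hs : N.edges = s.map f) {A : Finset N.V} {p : α → Prop} [DecidablePred p] {w : α → ℝ}
    (hp : ∀ a, ((∃ u ∈ f a, u ∈ A) ∧ ∃ v ∈ f a, v ∉ A) ↔ p a) (hw : ∀ a, N.cost (f a) = w a) :
    N.cutWeight A = ∑ a ∈ s, if p a then w a else 0 := by
  rw [cutWeight, cutset, Finset.sum_filter, hs, Finset.sum_map]
  exact Finset.sum_congr rfl fun a _ => if_congr (hp a) (hw a) rfl

/-- Each minimum cut is a 0/1 combination of the edge costs, so rationally independent minimum cut
values are at most as many as the edges. -/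
lemma card_le_card_edges_of_linearIndependent_mincut {ι : Type*} [Fintype ι] (N : Network k)
    (S : ι → Finset (Fin k)) (h : LinearIndependent ℚ fun x => N.mincut (S x)) :
    Fintype.card ι ≤ N.edges.card := by
  choose A _ hA using fun x => (N.isLeast_mincut (S x)).1
  let v : ι → N.edges → ℚ := fun x e => if (e : Sym2 N.V) ∈ N.cutset (A x) then 1 else 0
  let φ : (N.edges → ℚ) →ₗ[ℚ] ℝ := Fintype.linearCombination ℚ fun e => N.cost e
  have hv : φ ∘ v = fun x => N.mincut (S x) := by
    funext x
    rw [← hA x]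
    simp only [Function.comp_apply, φ, v, Fintype.linearCombination_apply, ite_smul, one_smul,
      zero_smul, cutWeight]
    rw [Finset.sum_coe_sort N.edges fun e => if e ∈ N.cutset (A x) then N.cost e else 0,
      ← Finset.sum_filter, Finset.filter_mem_eq_inter, Finset.inter_eq_right.2]
    exact Finset.filter_subset _ _
  have hli : LinearIndependent ℚ v := LinearIndependent.of_comp φ (hv ▸ h)
  simpa using hli.fintype_card_le_finrank

end Network

lemma exists_pos_linearIndependent_real (ι : Type) [Finite ι] :
    ∃ c : ι → ℝ, (∀ i, 0 < c i) ∧ LinearIndependent ℚ c := by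
  cases nonempty_fintype ι
  have hrank : (Fintype.card ι : Cardinal) ≤ Module.rank ℚ ℝ := by
    rw [Real.rank_rat_real]
    exact (Cardinal.natCast_lt_aleph0.trans Cardinal.aleph0_lt_continuum).le
  obtain ⟨b, hb⟩ := exists_linearIndependent_of_le_rank hrank
  have hc := hb.comp _ (Fintype.equivFin ι).injective
  set c := b ∘ Fintype.equivFin ι
  refine ⟨fun i => |c i|, fun i => abs_pos.2 (hc.ne_zero i), ?_⟩
  convert hc.units_smul fun i => if 0 < c i then 1 else -1 using 1
  funext i
  simp only [Pi.smul_apply']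
  split_ifs with h
  · simp [abs_of_pos h]
  · simp [abs_of_nonpos (not_lt.1 h)]

section StarNetwork

variable {n : ℕ}

/-- Relative weights of the star of `T`: terminal `0` gets `2`, terminal `1` gets `2 |T| + 1`,
and terminal `j + 2` gets `2` or `0` according to whether `j ∈ T`. -/
def starWeight (T : Finset (Fin n)) : Fin (n + 2) → ℕ :=
  Fin.cons 2 (Fin.cons (2 * T.card + 1) fun j => if j ∈ T then 2 else 0)

/-- The edge joining a terminal to the centre of the star of `T`. -/
def starEdge (p : Fin (n + 2) × Finset (Fin n)) : Sym2 (Fin (n + 2) ⊕ Finset (Fin n)) :=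
  s(Sum.inl p.1, Sum.inr p.2)

lemma starEdge_injective : Function.Injective (starEdge (n := n)) := by
  rintro ⟨i, T⟩ ⟨j, U⟩ h
  simpa [starEdge] using h

/-- The union over `T` of the stars with weights `starWeight T`, scaled by `c T`. -/
noncomputable def starNetwork (c : Finset (Fin n) → ℝ) : Network (n + 2) where
  V := Fin (n + 2) ⊕ Finset (Fin n)
  edges := (Finset.univ.filter fun p : Fin (n + 2) × Finset (Fin n) =>
    0 < starWeight p.2 p.1).map ⟨starEdge, starEdge_injective⟩
  cost := Function.extend starEdge (fun p => c p.2 * starWeight p.2 p.1) 0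
  term := Sum.inl
  term_inj := Sum.inl_injective

lemma starNetwork_cost (c : Finset (Fin n) → ℝ) (p : Fin (n + 2) × Finset (Fin n)) :
    (starNetwork c).cost (starEdge p) = c p.2 * starWeight p.2 p.1 :=
  starEdge_injective.extend_apply (fun p => c p.2 * (starWeight p.2 p.1 : ℝ)) 0 p

lemma starNetwork_posCosts {c : Finset (Fin n) → ℝ} (hc : ∀ T, 0 < c T) :
    (starNetwork c).PosCosts := by
  intro e he
  obtain ⟨p, hp, rfl⟩ := Finset.mem_map.1 he
  have hw : 0 < starWeight p.2 p.1 := (Finset.mem_filter.1 hp).2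
  exact (mul_pos (hc _) (by exact_mod_cast hw)).trans_eq (starNetwork_cost c p).symm

lemma starNetwork_cutWeight (c : Finset (Fin n) → ℝ)
    (A : Finset (Fin (n + 2) ⊕ Finset (Fin n))) :
    (starNetwork c).cutWeight A =
      ∑ T, c T *
        ((∑ i, if (Sum.inl i ∈ A ↔ Sum.inr T ∈ A) then 0 else starWeight T i : ℕ) : ℝ) := by
  have hcross : ∀ p : Fin (n + 2) × Finset (Fin n),
      ((∃ u ∈ starEdge p, u ∈ A) ∧ ∃ v ∈ starEdge p, v ∉ A) ↔
        ¬ (Sum.inl p.1 ∈ A ↔ Sum.inr p.2 ∈ A) := by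
    intro p
    simp only [starEdge, Sym2.mem_iff, exists_eq_or_imp, exists_eq_left]
    tauto
  refine (Network.cutWeight_of_edges_eq_map (starNetwork c) rfl hcross
    (starNetwork_cost c)).trans ?_
  rw [Finset.sum_filter, ← Finset.univ_product_univ, Finset.sum_product_right]
  refine Finset.sum_congr rfl fun T _ => ?_
  rw [Nat.cast_sum, Finset.mul_sum]
  refine Finset.sum_congr rfl fun i _ => ?_
  by_cases hw : 0 < starWeight T i
  · by_cases hi : (Sum.inl i ∈ A ↔ Sum.inr T ∈ A) <;> simp [hw, hi]
  · have h0 : starWeight T i = 0 := by omega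
    simp [h0]

/-- The terminal set consisting of terminal `0` and the terminals `j + 2` with `j ∈ X`. -/
noncomputable def starSide (X : Finset (Fin n)) : Finset (Fin (n + 2)) :=
  Finset.univ.filter (Fin.cons True (Fin.cons False (· ∈ X)) : Fin (n + 2) → Prop)

lemma sum_starWeight_starSide (T X : Finset (Fin n)) :
    (∑ i, if i ∈ starSide X then starWeight T i else 0) = 2 + 2 * (T ∩ X).card := by
  have h : ∑ j, (if j ∈ X then if j ∈ T then 2 else 0 else 0) = 2 * (T ∩ X).card := by
    rw [mul_comm, ← smul_eq_mul, ← Finset.sum_const, ← Finset.sum_filter, ← Finset.sum_filter]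
    congr 1
    ext j
    simp [and_comm]
  rw [Fin.sum_univ_succ, Fin.sum_univ_succ]
  simpa [starSide, starWeight] using h

lemma sum_starWeight_compl_starSide (T X : Finset (Fin n)) :
    (∑ i, if i ∈ starSide X then 0 else starWeight T i) =
      2 * T.card + 1 + 2 * (T \ X).card := by
  have h : ∑ j, (if j ∈ X then 0 else if j ∈ T then 2 else 0) = 2 * (T \ X).card := by
    rw [mul_comm, ← smul_eq_mul, ← Finset.sum_const]
    simp_rw [← ite_not (_ ∈ X)]
    rw [← Finset.sum_filter, ← Finset.sum_filter]
    congr 1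
    ext j
    simp [and_comm]
  rw [Fin.sum_univ_succ, Fin.sum_univ_succ]
  simpa [starSide, starWeight] using h

/-- The minimum `starSide X`-separating cut within the unscaled star of `T`. -/
def starCut (T X : Finset (Fin n)) : ℕ :=
  min (2 * T.card + 1 + 2 * (T \ X).card) (2 + 2 * (T ∩ X).card)

lemma starCut_add (T X : Finset (Fin n)) :
    starCut T X + (if T ⊆ X then 1 else 0) = 2 + 2 * (T ∩ X).card := by
  have h := Finset.card_sdiff_add_card_inter T X
  have h' : T ⊆ X ↔ (T \ X).card = 0 := by
    rw [Finset.card_eq_zero, Finset.sdiff_eq_empty_iff_subset]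
  rw [starCut]
  split_ifs with hX <;> rw [h'] at hX <;> omega

lemma sum_star_of_separates (T X : Finset (Fin n)) {A : Finset (Fin (n + 2) ⊕ Finset (Fin n))}
    (hA : ∀ i, Sum.inl i ∈ A ↔ i ∈ starSide X) :
    (∑ i, if (Sum.inl i ∈ A ↔ Sum.inr T ∈ A) then 0 else starWeight T i) =
      if Sum.inr T ∈ A then 2 * T.card + 1 + 2 * (T \ X).card else 2 + 2 * (T ∩ X).card := by
  rw [← sum_starWeight_starSide, ← sum_starWeight_compl_starSide]
  split_ifs with h <;> simp [hA, h]

lemma starNetwork_mincut {c : Finset (Fin n) → ℝ} (hc : ∀ T, 0 < c T) (X : Finset (Fin n)) :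
    (starNetwork c).mincut (starSide X) = ∑ T, c T * starCut T X := by
  refine ((starNetwork c).isLeast_mincut (starSide X)).unique ⟨?_, ?_⟩
  · let A : Finset (Fin (n + 2) ⊕ Finset (Fin n)) := (starSide X).disjSum
      (Finset.univ.filter fun T =>
        2 * T.card + 1 + 2 * (T \ X).card ≤ 2 + 2 * (T ∩ X).card)
    have hA : ∀ i, Sum.inl i ∈ A ↔ i ∈ starSide X := fun i => by simp [A]
    refine ⟨A, hA, ?_⟩
    rw [starNetwork_cutWeight]
    refine Finset.sum_congr rfl fun T _ => ?_
    rw [sum_star_of_separates T X hA, starCut, min_def]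
    simp [A]
  · rintro w ⟨A, hA, rfl⟩
    refine le_of_le_of_eq ?_ (starNetwork_cutWeight c A).symm
    refine Finset.sum_le_sum fun T _ => mul_le_mul_of_nonneg_left ?_ (hc T).le
    rw [Nat.cast_le, sum_star_of_separates T X hA, starCut]
    split_ifs
    exacts [min_le_left _ _, min_le_right _ _]

lemma eq_zero_of_sum_superset_eq_zero {g : Finset (Fin n) → ℚ}
    (h : ∀ T, ∑ X : Finset (Fin n), (if T ⊆ X then g X else 0) = 0) (T : Finset (Fin n)) :
    g T = 0 := by
  induction T using WellFoundedGT.induction with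
  | ind T ih =>
    rw [← h T, Finset.sum_eq_single T, if_pos subset_rfl]
    · intro X _ hX
      split_ifs with hTX
      · exact ih X (lt_of_le_of_ne hTX hX.symm)
      · rfl
    · simp

lemma eq_zero_of_sum_mul_starCut_eq_zero {g : Finset (Fin n) → ℚ}
    (h : ∀ T, ∑ X, g X * starCut T X = 0) (T : Finset (Fin n)) : g T = 0 := by
  have hkey : ∀ T, ∑ X : Finset (Fin n), (if T ⊆ X then g X else 0) =
      2 * ∑ X, g X + 2 * ∑ i ∈ T, ∑ X : Finset (Fin n), (if {i} ⊆ X then g X else 0) := by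
    intro T
    rw [Finset.sum_comm, Finset.mul_sum, Finset.mul_sum, ← Finset.sum_add_distrib,
      ← sub_eq_zero, ← Finset.sum_sub_distrib, ← neg_eq_zero, ← Finset.sum_neg_distrib]
    refine Eq.trans ?_ (h T)
    refine Finset.sum_congr rfl fun X _ => ?_
    have hX : (starCut T X : ℚ) + (if T ⊆ X then 1 else 0) = 2 + 2 * (T ∩ X).card := by
      exact_mod_cast starCut_add T X
    have hcard : ∑ i ∈ T, (if {i} ⊆ X then g X else 0) = (T ∩ X).card * g X := by
      simp only [Finset.singleton_subset_iff]
      rw [← Finset.sum_filter, Finset.filter_mem_eq_inter, Finset.sum_const, nsmul_eq_mul]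
    have hite : (if T ⊆ X then g X else 0) = g X * (if T ⊆ X then 1 else 0) := by simp
    rw [hcard, hite]
    linear_combination -g X * hX
  have hsum : ∑ X, g X = 0 := by
    have := hkey ∅
    simp only [Finset.empty_subset, if_true, Finset.sum_empty] at this
    linarith
  have hsingle : ∀ i : Fin n, ∑ X : Finset (Fin n), (if {i} ⊆ X then g X else 0) = 0 := by
    intro i
    have := hkey {i}
    rw [Finset.sum_singleton, hsum] at this
    linarith
  exact eq_zero_of_sum_superset_eq_zero (fun T => by
    rw [hkey T, hsum, Finset.sum_eq_zero fun i _ => hsingle i]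
    simp) T

lemma linearIndependent_starNetwork_mincut {c : Finset (Fin n) → ℝ} (hc : ∀ T, 0 < c T)
    (hli : LinearIndependent ℚ c) :
    LinearIndependent ℚ fun X => (starNetwork c).mincut (starSide X) := by
  rw [Fintype.linearIndependent_iff] at hli ⊢
  intro g hg
  refine eq_zero_of_sum_mul_starCut_eq_zero (hli _ ?_)
  rw [← hg]
  simp only [starNetwork_mincut hc, Finset.sum_smul, Finset.smul_sum]
  rw [Finset.sum_comm]
  refine Finset.sum_congr rfl fun X _ => Finset.sum_congr rfl fun T _ => ?_
  simp only [Rat.smul_def]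
  push_cast
  ring

end StarNetwork

/-- For every `k ≥ 3` there is a `k`-terminal network (with positive edge costs)
such that every mimicking network for it has at least `2 ^ (k - 2)` edges. -/
theorem exists_network_mimicking_lower_bound (k : ℕ) (hk : 3 ≤ k) :
    ∃ N : Network k, N.PosCosts ∧
      ∀ N' : Network k, N'.PosCosts → N'.IsMimicking N →
        2 ^ (k - 2) ≤ N'.edges.card := by
  obtain ⟨n, rfl⟩ : ∃ n, k = n + 2 := ⟨k - 2, by omega⟩
  obtain ⟨c, hc, hli⟩ := exists_pos_linearIndependent_real (Finset (Fin n))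
  refine ⟨starNetwork c, starNetwork_posCosts hc, fun N' _ hN' => ?_⟩
  have h := N'.card_le_card_edges_of_linearIndependent_mincut starSide
    (by simpa only [hN' _] using linearIndependent_starNetwork_mincut hc hli)
  simpa using h
end

section
/- For every integer k ≥ 3 there exists a k-terminal network (G,c) with terminal set Q such that: (i) for every nontrivial partition Q = S ⊎ S̄ the minimum S-separating cut of (G,c) is unique as an edge set, and (ii) the cutset-edge incidence matrix A_{G,c} has rank at least 2^(k−2) over ℝ. -/
open scoped Classical

namespace Network

variable {k : ℕ}

/-- `F` is the edge set of a minimum `S`-separating cut of `N`. -/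
def IsMinCutset (N : Network k) (S : Finset (Fin k))
    (F : Finset (Sym2 N.V)) : Prop :=
  ∃ A : Finset N.V, N.Separates S A ∧ N.cutset A = F ∧ N.cutWeight A = N.mincut S

end Network

namespace Network

/-- The bipartite network joining each of the `k` terminals `i` to each inner vertex `j` by an edge
of cost `w j i`, where edges of cost zero are left out. -/
noncomputable def bipartite {k : ℕ} {J : Type} [Fintype J] (w : J → Fin k → ℕ) : Network k where
  V := Fin k ⊕ J
  edges := ({p : J × Fin k | w p.1 p.2 ≠ 0} : Finset (J × Fin k)).image
    fun p => s(Sum.inl p.2, Sum.inr p.1)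
  cost e := ∑ p : J × Fin k, if s(Sum.inl p.2, Sum.inr p.1) = e then (w p.1 p.2 : ℝ) else 0
  term := Sum.inl
  term_inj := Sum.inl_injective

section Bipartite

variable {k : ℕ} {J : Type} [Fintype J] (w : J → Fin k → ℕ)

/-- The inner vertex of the bipartite network with index `j`. -/
noncomputable def inner (j : J) : (bipartite w).V := Sum.inr j

/-- The pair joining an inner vertex to a terminal. -/
noncomputable def link (p : J × Fin k) : Sym2 (bipartite w).V :=
  s((bipartite w).term p.2, inner w p.1)

theorem link_injective : Function.Injective (link w) := by
  rintro ⟨j, i⟩ ⟨j', i'⟩ h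
  have h' : (s(Sum.inl i, Sum.inr j) : Sym2 (Fin k ⊕ J)) = s(Sum.inl i', Sum.inr j') := h
  simpa [and_comm] using h'

theorem mem_bipartite_edges {e : Sym2 (bipartite w).V} :
    e ∈ (bipartite w).edges ↔ ∃ p : J × Fin k, w p.1 p.2 ≠ 0 ∧ link w p = e :=
  Finset.mem_image.trans (by simp only [Finset.mem_filter_univ]; rfl)

theorem link_mem_edges {p : J × Fin k} (h : w p.1 p.2 ≠ 0) : link w p ∈ (bipartite w).edges :=
  (mem_bipartite_edges w).2 ⟨p, h, rfl⟩

theorem bipartite_cost_link (p : J × Fin k) : (bipartite w).cost (link w p) = w p.1 p.2 := by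
  change ∑ q : J × Fin k, (if link w q = link w p then (w q.1 q.2 : ℝ) else 0) = _
  simp only [(link_injective w).eq_iff]
  simp

theorem bipartite_posCosts : (bipartite w).PosCosts := by
  intro e he
  obtain ⟨p, hp, rfl⟩ := (mem_bipartite_edges w).1 he
  rw [bipartite_cost_link]
  exact_mod_cast Nat.pos_of_ne_zero hp

theorem link_mem_cutset {p : J × Fin k} (h : w p.1 p.2 ≠ 0) (A : Finset (bipartite w).V) :
    link w p ∈ (bipartite w).cutset A ↔ ¬((bipartite w).term p.2 ∈ A ↔ inner w p.1 ∈ A) := by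
  have := link_mem_edges w h
  simp only [cutset, Finset.mem_filter, link, Sym2.mem_iff, exists_eq_or_imp,
    exists_eq_left]
  tauto

/-- The cost of the edges at the inner vertex `j` cut by an `S`-separating cut, where `b` tells
whether `j` lies on the side of `S`. -/
noncomputable def starCost (S : Finset (Fin k)) (j : J) (b : Prop) : ℕ :=
  if b then ∑ i ∈ Sᶜ, w j i else ∑ i ∈ S, w j i

theorem bipartite_cutWeight {S : Finset (Fin k)} {A : Finset (bipartite w).V}
    (hA : (bipartite w).Separates S A) :
    (bipartite w).cutWeight A = ∑ j, (starCost w S j (inner w j ∈ A) : ℝ) := by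
  have key : (bipartite w).cutset A =
      ({p : J × Fin k | w p.1 p.2 ≠ 0 ∧ ¬(p.2 ∈ S ↔ inner w p.1 ∈ A)} :
        Finset (J × Fin k)).image (link w) := by
    ext e
    rw [Finset.mem_image]
    constructor
    · intro he
      obtain ⟨p, hp, rfl⟩ := (mem_bipartite_edges w).1 (Finset.mem_filter.1 he).1
      rw [link_mem_cutset w hp, hA] at he
      exact ⟨p, by simpa using ⟨hp, he⟩, rfl⟩
    · rintro ⟨p, hp, rfl⟩
      obtain ⟨hw, h⟩ := (Finset.mem_filter.1 hp).2
      exact (link_mem_cutset w hw A).2 (by rwa [hA])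
  rw [cutWeight, key, Finset.sum_image (link_injective w).injOn]
  simp only [bipartite_cost_link]
  rw [Finset.sum_filter, Fintype.sum_prod_type]
  refine Finset.sum_congr rfl fun j _ => ?_
  unfold starCost
  split_ifs with hj
  · push_cast
    rw [← Finset.sum_subset (Finset.subset_univ Sᶜ)]
    · refine Finset.sum_congr rfl fun i hi => ?_
      by_cases h0 : w j i = 0 <;> simp_all
    · intro i _ hi
      simp_all
  · push_cast
    rw [← Finset.sum_subset (Finset.subset_univ S)]
    · refine Finset.sum_congr rfl fun i hi => ?_
      by_cases h0 : w j i = 0 <;> simp_all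
    · intro i _ hi
      simp_all

/-- The side of the `S`-separating cut in which every inner vertex follows the weighted majority
of the terminals. -/
noncomputable def majoritySide (S : Finset (Fin k)) : Finset (bipartite w).V :=
  Finset.disjSum S ({j : J | ∑ i ∈ Sᶜ, w j i < ∑ i ∈ S, w j i} : Finset J)

theorem inner_mem_majoritySide {S : Finset (Fin k)} {j : J} :
    inner w j ∈ majoritySide w S ↔ ∑ i ∈ Sᶜ, w j i < ∑ i ∈ S, w j i := by
  refine Finset.inr_mem_disjSum.trans ?_
  simp

theorem separates_majoritySide (S : Finset (Fin k)) :
    (bipartite w).Separates S (majoritySide w S) := fun _ => Finset.inl_mem_disjSum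

theorem starCost_majoritySide_le (S : Finset (Fin k)) (j : J) (b : Prop) :
    starCost w S j (inner w j ∈ majoritySide w S) ≤ starCost w S j b := by
  simp only [starCost, inner_mem_majoritySide]
  split_ifs <;> omega

theorem cutWeight_majoritySide_le {S : Finset (Fin k)} {A : Finset (bipartite w).V}
    (hA : (bipartite w).Separates S A) :
    (bipartite w).cutWeight (majoritySide w S) ≤ (bipartite w).cutWeight A := by
  rw [bipartite_cutWeight w hA, bipartite_cutWeight w (separates_majoritySide w S)]
  exact Finset.sum_le_sum fun j _ => Nat.cast_le.2 (starCost_majoritySide_le w S j _)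

theorem bipartite_mincut (S : Finset (Fin k)) :
    (bipartite w).mincut S = (bipartite w).cutWeight (majoritySide w S) := by
  refine IsLeast.csInf_eq ⟨⟨_, separates_majoritySide w S, rfl⟩, ?_⟩
  rintro _ ⟨A, hA, rfl⟩
  exact cutWeight_majoritySide_le w hA

/-- If no inner vertex of a bipartite network sees a tie between `S` and its complement, then the
minimum `S`-separating cut is unique and every inner vertex follows the majority. -/
theorem bipartite_isMinCutset_iff {S : Finset (Fin k)}
    (hS : ∀ j, ∑ i ∈ Sᶜ, w j i ≠ ∑ i ∈ S, w j i) {F : Finset (Sym2 (bipartite w).V)} :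
    (bipartite w).IsMinCutset S F ↔ F = (bipartite w).cutset (majoritySide w S) := by
  constructor
  · rintro ⟨A, hA, rfl, hmin⟩
    rw [bipartite_mincut, bipartite_cutWeight w hA,
      bipartite_cutWeight w (separates_majoritySide w S), eq_comm] at hmin
    have hj := (Finset.sum_eq_sum_iff_of_le fun j _ =>
      Nat.cast_le.2 (starCost_majoritySide_le w S j _)).1 hmin
    congr 1
    ext v
    obtain ⟨i, rfl⟩ | ⟨j, rfl⟩ : (∃ i, (bipartite w).term i = v) ∨ ∃ j, inner w j = v :=
      v.casesOn (fun i => .inl ⟨i, rfl⟩) fun j => .inr ⟨j, rfl⟩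
    · exact (hA i).trans (separates_majoritySide w S i).symm
    · have h := Nat.cast_injective (hj j (Finset.mem_univ j))
      have := hS j
      rw [inner_mem_majoritySide]
      simp only [starCost, inner_mem_majoritySide] at h
      split_ifs at h with h1 h2 h2
      · exact iff_of_true h2 h1
      · omega
      · omega
      · exact iff_of_false h2 h1
  · rintro rfl
    exact ⟨_, separates_majoritySide w S, rfl, (bipartite_mincut w S).symm⟩

end Bipartite

end Network

/-- The inclusion matrix of the subsets of a finite set is invertible. -/
theorem isUnit_inclusionMatrix (α : Type*) [Fintype α] [DecidableEq α] :
    IsUnit (Matrix.of fun S T : Finset α => if T ⊆ S then (1 : ℝ) else 0) := by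
  rw [← Matrix.mulVec_injective_iff_isUnit, ← Matrix.coe_mulVecLin, ← LinearMap.ker_eq_bot,
    LinearMap.ker_eq_bot']
  intro v hv
  funext S
  induction S using Finset.strongInduction with
  | H S ih =>
    have h := congrFun hv S
    simp only [Matrix.mulVecLin_apply, Matrix.mulVec, dotProduct, Matrix.of_apply] at h
    rw [Finset.sum_eq_single S] at h
    · simpa using h
    · intro T _ hT
      by_cases hTS : T ⊆ S
      · rw [ih T (hTS.ssubset_of_ne hT)]
        simp
      · simp [hTS]
    · simp

section Gadgets

variable {m : ℕ}

/-- The set of terminals made of `1` and the copy of `T` among the terminals from `2` on. -/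
def terminalSet (T : Finset (Fin m)) : Finset (Fin (m + 2)) :=
  (insert 0 (T.map (Fin.succEmb m))).map (Fin.succEmb (m + 1))

theorem zero_notMem_terminalSet (T : Finset (Fin m)) : 0 ∉ terminalSet T := by
  simp [terminalSet, Fin.succ_ne_zero]

theorem card_terminalSet (T : Finset (Fin m)) : (terminalSet T).card = T.card + 1 := by
  rw [terminalSet, Finset.card_map, Finset.card_insert_of_notMem (by simp [Fin.succ_ne_zero]),
    Finset.card_map]

theorem terminalSet_subset {T S : Finset (Fin m)} : terminalSet T ⊆ terminalSet S ↔ T ⊆ S := by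
  rw [terminalSet, terminalSet, Finset.map_subset_map,
    Finset.insert_subset_insert_iff (by simp [Fin.succ_ne_zero]), Finset.map_subset_map]

/-- Edge costs for which an inner vertex `T` leaves the side of the terminal `0` only if all
terminals in `terminalSet T` do. -/
noncomputable def conjunctionCost (T : Finset (Fin m)) (i : Fin (m + 2)) : ℕ :=
  (if i ∈ terminalSet T then 2 else 0) + if i = 0 then 2 * T.card + 1 else 0

theorem sum_conjunctionCost (T : Finset (Fin m)) (S : Finset (Fin (m + 2))) :
    ∑ i ∈ S, conjunctionCost T i =
      2 * (S ∩ terminalSet T).card + if 0 ∈ S then 2 * T.card + 1 else 0 := by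
  simp only [conjunctionCost, Finset.sum_add_distrib, Finset.sum_ite_eq', Finset.sum_ite_mem,
    Finset.sum_const, smul_eq_mul, mul_comm]

theorem card_inter_add_card_compl_inter_terminalSet (T : Finset (Fin m))
    (S : Finset (Fin (m + 2))) :
    (S ∩ terminalSet T).card + (Sᶜ ∩ terminalSet T).card = T.card + 1 := by
  rw [← card_terminalSet, Finset.inter_comm, Finset.inter_comm Sᶜ, ← Finset.sdiff_eq_inter_compl,
    Finset.card_inter_add_card_sdiff]

theorem sum_conjunctionCost_compl_ne (T : Finset (Fin m)) (S : Finset (Fin (m + 2))) :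
    ∑ i ∈ Sᶜ, conjunctionCost T i ≠ ∑ i ∈ S, conjunctionCost T i := by
  rw [sum_conjunctionCost, sum_conjunctionCost]
  by_cases h : (0 : Fin (m + 2)) ∈ S <;> simp only [h, Finset.mem_compl, if_true, if_false,
    not_true, not_false_iff] <;> omega

theorem sum_conjunctionCost_compl_lt_iff (T S : Finset (Fin m)) :
    ∑ i ∈ (terminalSet S)ᶜ, conjunctionCost T i < ∑ i ∈ terminalSet S, conjunctionCost T i ↔
      T ⊆ S := by
  have h := card_inter_add_card_compl_inter_terminalSet T (terminalSet S)
  have h1 : ((terminalSet S)ᶜ ∩ terminalSet T).card = 0 ↔ T ⊆ S := by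
    rw [Finset.card_eq_zero, Finset.inter_comm, ← Finset.sdiff_eq_inter_compl,
      Finset.sdiff_eq_empty_iff_subset, terminalSet_subset]
  rw [← h1, sum_conjunctionCost, sum_conjunctionCost, if_neg (zero_notMem_terminalSet S),
    if_pos (Finset.mem_compl.2 (zero_notMem_terminalSet S))]
  omega

end Gadgets

/-- For every `k ≥ 3` there is a `k`-terminal network with positive edge costs whose
minimum `S`-separating cutsets are unique for every nontrivial terminal partition,
and whose cutset-edge incidence matrix has rank at least `2 ^ (k - 2)` over `ℝ`. -/
theorem exists_network_unique_mincuts_high_rank (k : ℕ) (hk : 3 ≤ k) :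
    ∃ N : Network k, N.PosCosts ∧
      (∀ S : Finset (Fin k), S ≠ ∅ → S ≠ Finset.univ →
        ∃! F : Finset (Sym2 N.V), N.IsMinCutset S F) ∧
      ∀ M : Matrix {S : Finset (Fin k) // S ≠ ∅ ∧ S ≠ Finset.univ} {e // e ∈ N.edges} ℝ,
        (∀ (S : {S : Finset (Fin k) // S ≠ ∅ ∧ S ≠ Finset.univ})
          (F : Finset (Sym2 N.V)), N.IsMinCutset S.1 F →
          ∀ e : {e // e ∈ N.edges}, M S e = if (e : Sym2 N.V) ∈ F then 1 else 0) →
        2 ^ (k - 2) ≤ M.rank := by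
  obtain ⟨m, rfl⟩ : ∃ m, k = m + 2 := ⟨k - 2, by omega⟩
  have hmin (S : Finset (Fin (m + 2))) (F) :=
    Network.bipartite_isMinCutset_iff (conjunctionCost (m := m))
      (fun T => sum_conjunctionCost_compl_ne T S) (F := F)
  refine ⟨Network.bipartite (conjunctionCost (m := m)), Network.bipartite_posCosts _,
    fun S _ _ => ⟨_, (hmin S _).2 rfl, fun F hF => (hmin S F).1 hF⟩, fun M hM => ?_⟩
  have hpos (T : Finset (Fin m)) : conjunctionCost T 0 ≠ 0 := by simp [conjunctionCost]
  let row (S : Finset (Fin m)) : {S : Finset (Fin (m + 2)) // S ≠ ∅ ∧ S ≠ Finset.univ} :=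
    ⟨terminalSet S, Finset.card_ne_zero.1 (by simp [card_terminalSet]) |>.ne_empty,
      fun h => zero_notMem_terminalSet S (h ▸ Finset.mem_univ 0)⟩
  let col (T : Finset (Fin m)) : {e // e ∈ (Network.bipartite (conjunctionCost (m := m))).edges} :=
    ⟨Network.link _ (T, 0), Network.link_mem_edges _ (hpos T)⟩
  have hsub : M.submatrix row col =
      Matrix.of fun S T : Finset (Fin m) => if T ⊆ S then (1 : ℝ) else 0 := by
    ext S T
    have h0 : (Network.bipartite (conjunctionCost (m := m))).term 0 ∉
        Network.majoritySide (conjunctionCost (m := m)) (terminalSet S) := fun h =>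
      zero_notMem_terminalSet S ((Network.separates_majoritySide _ (terminalSet S) 0).1 h)
    have hmem := Network.link_mem_cutset conjunctionCost (p := (T, 0)) (hpos T)
      (Network.majoritySide conjunctionCost (terminalSet S))
    rw [Network.inner_mem_majoritySide, sum_conjunctionCost_compl_lt_iff, iff_false_left h0,
      not_not] at hmem
    rw [Matrix.submatrix_apply, hM (row S) _ ((hmin _ _).2 rfl) (col T), Matrix.of_apply]
    exact if_congr hmem rfl rfl
  calc 2 ^ (m + 2 - 2) = Fintype.card (Finset (Fin m)) := by simp
    _ = (M.submatrix row col).rank := by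
      rw [hsub]
      exact (Matrix.rank_of_isUnit _ (isUnit_inclusionMatrix (Fin m))).symm
    _ ≤ M.rank := Matrix.rank_submatrix_le M row col
end

section
/- For every integer k ≥ 6 with k ≡ 6 (mod 8), writing ℓ = C(k−1, ⌊(k−1)/2⌋), there exists a k-terminal network (G,c) with terminal set Q and at least C(ℓ, ℓ/2) vertices such that for every pair of distinct vertices u, v ∈ V(G) there exists a subset S ⊆ Q with the property that every minimum S-separating bipartition of G separates u from v, i.e., exactly one of u, v lies in A for every vertex bipartition (A, V(G)∖A) with S ⊆ A and Q∖S ⊆ V(G)∖A whose crossing-edge weight equals mincut(G,c,S,Q∖S). Consequently, no two vertices of G can be identified without strictly increasing the weight of some minimum S-separating cut. -/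
/-- A `k`-terminal network: a finite graph given by a symmetric nonnegative rational
edge cost function (cost `0` meaning no edge), with an injective labelling of `k`
terminal vertices. -/
structure NetworkQ (k : ℕ) : Type 1 where
  V : Type
  [fintypeV : Fintype V]
  [decEqV : DecidableEq V]
  cost : V → V → ℚ
  cost_symm : ∀ a b : V, cost a b = cost b a
  cost_nonneg : ∀ a b : V, 0 ≤ cost a b
  term : Fin k → V
  term_inj : Function.Injective term

attribute [instance] NetworkQ.fintypeV NetworkQ.decEqV

namespace NetworkQ

variable {k : ℕ}

/-- The bipartition `(A, V ∖ A)` is `S`-separating: the terminals indexed by `S` lie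
in `A` and the remaining terminals lie outside `A`. -/
def SepBip (N : NetworkQ k) (S : Finset (Fin k)) (A : Finset N.V) : Prop :=
  (∀ i ∈ S, N.term i ∈ A) ∧ ∀ i ∉ S, N.term i ∉ A

/-- The total cost of the edges crossing the bipartition `(A, V ∖ A)`. -/
def cutWeight (N : NetworkQ k) (A : Finset N.V) : ℚ :=
  ∑ a ∈ A, ∑ b ∈ Aᶜ, N.cost a b

/-- `(A, V ∖ A)` is a minimum `S`-separating bipartition of `N`. -/
def IsMinSepBip (N : NetworkQ k) (S : Finset (Fin k)) (A : Finset N.V) : Prop :=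
  N.SepBip S A ∧ ∀ B : Finset N.V, N.SepBip S B → N.cutWeight A ≤ N.cutWeight B

end NetworkQ
namespace NetworkQ

/-- The sign `1` or `-1` of a Boolean value. -/
def boolSign (b : Bool) : ℚ := if b then 1 else -1

lemma boolSign_mul_self (b : Bool) : boolSign b * boolSign b = 1 := by
  cases b <;> simp [boolSign]

lemma boolSign_not (b : Bool) : boolSign (!b) = -boolSign b := by
  cases b <;> simp [boolSign]

lemma abs_boolSign (b : Bool) : |boolSign b| = 1 := by
  cases b <;> simp [boolSign]

section LocalOptimality

variable {k : ℕ} (N : NetworkQ k)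

lemma cutWeight_insert_add {A : Finset N.V} {v : N.V} (hv : v ∉ A) :
    N.cutWeight (insert v A) + ∑ a ∈ A, N.cost v a =
      N.cutWeight A + ∑ b ∈ (insert v A)ᶜ, N.cost v b := by
  have hc : Aᶜ = insert v (insert v A)ᶜ := by
    ext b
    by_cases hb : b = v <;> simp [hb, hv]
  have hn : v ∉ (insert v A)ᶜ := by simp
  have hA : N.cutWeight A =
      ∑ a ∈ A, (N.cost v a + ∑ b ∈ (insert v A)ᶜ, N.cost a b) := by
    unfold cutWeight
    refine Finset.sum_congr rfl fun a _ => ?_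
    rw [hc, Finset.sum_insert hn, N.cost_symm]
  rw [hA, cutWeight, Finset.sum_insert hv, Finset.sum_add_distrib]
  ring

lemma sum_cost_mul_boolSign (A : Finset N.V) (v : N.V) :
    ∑ b, N.cost v b * boolSign (decide (b ∈ A)) =
      ∑ b ∈ A, N.cost v b - ∑ b ∈ Aᶜ, N.cost v b := by
  rw [← Finset.sum_add_sum_compl A, sub_eq_add_neg, ← Finset.sum_neg_distrib]
  congr 1
  · exact Finset.sum_congr rfl fun b hb => by simp [boolSign, hb]
  · refine Finset.sum_congr rfl fun b hb => ?_
    rw [Finset.mem_compl] at hb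
    simp [boolSign, hb]

/-- In a minimum separating bipartition, every vertex other than the terminals lies on
the side to which its total edge cost is at least as large. -/
lemma IsMinSepBip.mem_majority {S : Finset (Fin k)} {A : Finset N.V}
    (hA : N.IsMinSepBip S A) {v : N.V} (hv : ∀ i, N.term i ≠ v) (x : Bool)
    (hx : 0 < boolSign x * ∑ b, N.cost v b * boolSign (decide (b ∈ A))) :
    decide (v ∈ A) = x := by
  rw [sum_cost_mul_boolSign] at hx
  have hself := N.cost_nonneg v v
  by_cases hvA : v ∈ A
  · cases x
    · exfalso
      have hsep : N.SepBip S (A.erase v) :=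
        ⟨fun i hi => Finset.mem_erase.2 ⟨hv i, hA.1.1 i hi⟩,
          fun i hi h => hA.1.2 i hi (Finset.mem_of_mem_erase h)⟩
      have hmin := hA.2 _ hsep
      have hins := N.cutWeight_insert_add (Finset.notMem_erase v A)
      rw [Finset.insert_erase hvA] at hins
      rw [← Finset.add_sum_erase A _ hvA] at hx
      simp only [boolSign] at hx
      norm_num at hx
      linarith
    · simpa using hvA
  · cases x
    · simpa using hvA
    · exfalso
      have hsep : N.SepBip S (insert v A) :=
        ⟨fun i hi => Finset.mem_insert_of_mem (hA.1.1 i hi), fun i hi h =>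
          (Finset.mem_insert.1 h).elim (hv i) (hA.1.2 i hi)⟩
      have hmin := hA.2 _ hsep
      have hins := N.cutWeight_insert_add hvA
      rw [Finset.compl_insert] at hins
      rw [← Finset.add_sum_erase Aᶜ _ (Finset.mem_compl.2 hvA)] at hx
      simp only [boolSign] at hx
      norm_num at hx
      linarith

end LocalOptimality

section Construction

variable {n : ℕ}

/-- The `n / 2`-element subsets of `Fin n`; for odd `n` they encode the balanced
bipartitions of `Fin (n + 1)`. -/
abbrev HalfSet (n : ℕ) : Type := {s : Finset (Fin n) // s.card = n / 2}

/-- Membership in the part containing `0` of the bipartition of `Fin (n + 1)` encoded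
by `T`. -/
def HalfSet.side (T : HalfSet n) : Fin (n + 1) → Bool :=
  Fin.cons true fun i => decide (i ∈ T.1)

/-- The number whose binary digits are given by the elements of `T`. -/
def HalfSet.code (T : HalfSet n) : ℕ := ∑ i ∈ T.1, 2 ^ (i : ℕ)

lemma HalfSet.code_injective : Function.Injective (HalfSet.code (n := n)) := by
  intro S T h
  have hmap : ∀ U : HalfSet n, U.code = ∑ j ∈ U.1.map Fin.valEmbedding, 2 ^ j := by
    intro U
    simp [HalfSet.code]
  rw [hmap, hmap] at h
  exact Subtype.ext (Finset.map_injective _ (Finset.geomSum_injective le_rfl h))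

lemma HalfSet.sum_mul_boolSign_mem (T : HalfSet n) (f : Fin n → ℚ) :
    ∑ i, f i * boolSign (decide (i ∈ T.1)) = 2 * ∑ i ∈ T.1, f i - ∑ i, f i := by
  have h : ∀ i, f i * boolSign (decide (i ∈ T.1)) =
      2 * (if i ∈ T.1 then f i else 0) - f i := by
    intro i
    by_cases hi : i ∈ T.1
    · simp [boolSign, hi]; ring
    · simp [boolSign, hi]
  simp_rw [h]
  rw [Finset.sum_sub_distrib, ← Finset.mul_sum]
  simp

lemma HalfSet.sum_boolSign_side (hn : n % 2 = 1) (T : HalfSet n) :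
    ∑ t, boolSign (T.side t) = 0 := by
  have h := T.sum_mul_boolSign_mem fun _ => 1
  have hcard : (n : ℚ) = 2 * (n / 2 : ℕ) + 1 := by
    have : n = 2 * (n / 2) + 1 := by omega
    exact_mod_cast this
  simp only [one_mul, Finset.sum_const, T.2, Finset.card_univ, Fintype.card_fin,
    nsmul_eq_mul, mul_one] at h
  rw [Fin.sum_univ_succ]
  simp only [HalfSet.side, Fin.cons_zero, Fin.cons_succ, h]
  simp only [boolSign, if_true]
  linarith

/-- `v` is the weighted majority vote of the terminals for a system of nonnegative
weights without (near) ties. -/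
def IsThreshold (v : HalfSet n → Bool) : Prop :=
  ∃ a : Fin (n + 1) → ℚ, (∀ t, 0 ≤ a t) ∧
    ∀ T : HalfSet n, 1 ≤ boolSign (v T) * ∑ t, a t * boolSign (T.side t)

/-- Negative weights are harmless: adding a constant to all weights does not change the
vote of a balanced bipartition. -/
lemma IsThreshold.of_weights (hn : n % 2 = 1) {v : HalfSet n → Bool} (b : Fin (n + 1) → ℚ)
    (hb : ∀ T : HalfSet n, 1 ≤ boolSign (v T) * ∑ t, b t * boolSign (T.side t)) :
    IsThreshold v := by
  refine ⟨fun t => b t + ∑ s, |b s|, fun t => ?_, fun T => ?_⟩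
  · have h := Finset.single_le_sum (f := fun s => |b s|) (fun s _ => abs_nonneg (b s))
      (Finset.mem_univ t)
    have h' := neg_abs_le (b t)
    linarith
  · simp only [add_mul, Finset.sum_add_distrib, ← Finset.mul_sum, T.sum_boolSign_side hn,
      mul_zero, add_zero]
    exact hb T

/-- The vertex agreeing with `v` at `S` and comparing codes with `S` elsewhere. -/
def upVertex (v : HalfSet n → Bool) (S : HalfSet n) : HalfSet n → Bool :=
  fun T => if T = S then v S else decide (S.code < T.code)

/-- The vertex agreeing with `v` at `S` and opposite to `upVertex v S` elsewhere. -/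
def downVertex (v : HalfSet n → Bool) (S : HalfSet n) : HalfSet n → Bool :=
  fun T => if T = S then v S else decide (T.code < S.code)

lemma boolSign_upVertex_add_downVertex (v : HalfSet n → Bool) (S T : HalfSet n) :
    boolSign (upVertex v S T) + boolSign (downVertex v S T) =
      if T = S then 2 * boolSign (v T) else 0 := by
  by_cases h : T = S
  · subst h
    simp [upVertex, downVertex]
    ring
  · have hne : T.code ≠ S.code := fun hc => h (HalfSet.code_injective hc)
    rcases lt_or_gt_of_ne hne with hlt | hlt <;>
      simp [upVertex, downVertex, h, hlt, hlt.not_gt, boolSign]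

lemma HalfSet.sum_pow_mul_boolSign (T : HalfSet n) :
    ∑ i : Fin n, (2 : ℚ) ^ (i : ℕ) * boolSign (decide (i ∈ T.1)) =
      2 * (T.code : ℚ) - ∑ i : Fin n, (2 : ℚ) ^ (i : ℕ) := by
  rw [T.sum_mul_boolSign_mem fun i => (2 : ℚ) ^ (i : ℕ)]
  simp [HalfSet.code]

lemma isThreshold_upVertex (hn : n % 2 = 1) (v : HalfSet n → Bool) (S : HalfSet n) :
    IsThreshold (upVertex v S) := by
  refine IsThreshold.of_weights hn
    (Fin.cons (∑ i : Fin n, (2 : ℚ) ^ (i : ℕ) - 2 * S.code + boolSign (v S))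
      fun i => (2 : ℚ) ^ (i : ℕ)) fun T => ?_
  rw [Fin.sum_univ_succ]
  simp only [HalfSet.side, Fin.cons_zero, Fin.cons_succ, T.sum_pow_mul_boolSign]
  by_cases h : T = S
  · subst h
    have := boolSign_mul_self (v T)
    simp only [upVertex, if_true]
    simp only [show boolSign true = 1 from rfl]
    nlinarith
  · have hne : T.code ≠ S.code := fun hc => h (HalfSet.code_injective hc)
    have hs := abs_le.1 (abs_boolSign (v S)).le
    simp only [upVertex, if_neg h]
    rcases lt_or_gt_of_ne hne with hlt | hlt
    · have hq : (T.code : ℚ) + 1 ≤ S.code := by exact_mod_cast hlt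
      simp only [hlt.not_gt, decide_false, boolSign, Bool.false_eq_true, if_false, if_true] at hs ⊢
      linarith
    · have hq : (S.code : ℚ) + 1 ≤ T.code := by exact_mod_cast hlt
      simp only [hlt, decide_true, boolSign, if_true] at hs ⊢
      linarith

lemma isThreshold_downVertex (hn : n % 2 = 1) (v : HalfSet n → Bool) (S : HalfSet n) :
    IsThreshold (downVertex v S) := by
  obtain ⟨a, -, ha⟩ := isThreshold_upVertex hn (fun T => !v T) S
  refine IsThreshold.of_weights hn (fun t => -a t) fun T => ?_
  have hneg : boolSign (downVertex v S T) = -boolSign (upVertex (fun T => !v T) S T) := by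
    rw [← boolSign_not]
    congr 1
    by_cases h : T = S
    · simp [downVertex, upVertex, h]
    · have hne : T.code ≠ S.code := fun hc => h (HalfSet.code_injective hc)
      rcases lt_or_gt_of_ne hne with hlt | hlt <;>
        simp [upVertex, downVertex, h, hlt, hlt.le]
  have hT := ha T
  simp only [hneg, neg_mul, Finset.sum_neg_distrib, neg_neg, mul_neg]
  exact hT

/-- The terminal `t` as a vertex: its side in every balanced bipartition. -/
def terminalVertex (t : Fin (n + 1)) : HalfSet n → Bool := fun T => T.side t

lemma terminalVertex_injective (hn : 3 ≤ n) :
    Function.Injective (terminalVertex (n := n)) := by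
  have hzero : ∀ j : Fin n, terminalVertex (0 : Fin (n + 1)) ≠ terminalVertex j.succ := by
    intro j h
    obtain ⟨s, hs, hcard⟩ := Finset.exists_subset_card_eq
      (s := (Finset.univ : Finset (Fin n)).erase j) (n := n / 2)
      (by rw [Finset.card_erase_of_mem (Finset.mem_univ j), Finset.card_fin]; omega)
    have hj : j ∉ s := fun hj => Finset.notMem_erase j _ (hs hj)
    have := congrFun h ⟨s, hcard⟩
    simp [terminalVertex, HalfSet.side, hj] at this
  intro t u h
  induction t using Fin.cases with
  | zero =>
    induction u using Fin.cases with
    | zero => rfl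
    | succ j => exact absurd h (hzero j)
  | succ i =>
    induction u using Fin.cases with
    | zero => exact absurd h.symm (hzero i)
    | succ j =>
      by_contra hne
      have hij : i ≠ j := fun hij => hne (hij ▸ rfl)
      obtain ⟨s, his, hs, hcard⟩ := Finset.exists_subsuperset_card_eq
        (s := {i}) (t := (Finset.univ : Finset (Fin n)).erase j) (n := n / 2)
        (by simpa using hij) (by simp; omega)
        (by rw [Finset.card_erase_of_mem (Finset.mem_univ j), Finset.card_fin]; omega)
      have hj : j ∉ s := fun hj => Finset.notMem_erase j _ (hs hj)
      have hi : i ∈ s := his (Finset.mem_singleton_self i)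
      have := congrFun h ⟨s, hcard⟩
      simp [terminalVertex, HalfSet.side, hi, hj] at this

open Classical in
/-- The cost contributed by the edges which serve to place `v`: a threshold vertex is
attached to the terminals by heavy edges, any other vertex is attached to threshold
vertices by light edges. -/
noncomputable def arcCost (v b : HalfSet n → Bool) : ℚ :=
  if h : IsThreshold v then
    ∑ t, if b = terminalVertex t then
      (2 * Fintype.card (HalfSet n) * Fintype.card (HalfSet n → Bool) + 1) * h.choose t else 0
  else
    ∑ S, ((if b = upVertex v S then 1 else 0) + (if b = downVertex v S then 1 else 0))

lemma arcCost_nonneg (v b : HalfSet n → Bool) : 0 ≤ arcCost v b := by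
  unfold arcCost
  split_ifs with h
  · refine Finset.sum_nonneg fun t _ => ?_
    have := h.choose_spec.1 t
    split_ifs <;> positivity
  · refine Finset.sum_nonneg fun S _ => ?_
    split_ifs <;> norm_num

lemma arcCost_le {v : HalfSet n → Bool} (hv : ¬ IsThreshold v) (b : HalfSet n → Bool) :
    arcCost v b ≤ 2 * Fintype.card (HalfSet n) := by
  rw [arcCost, dif_neg hv]
  refine (Finset.sum_le_card_nsmul _ _ 2 fun S _ => ?_).trans ?_
  · split_ifs <;> norm_num
  · simp [mul_comm]

lemma arcCost_eq_zero_of_isThreshold {v b : HalfSet n → Bool} (hv : IsThreshold v)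
    (hb : ∀ t, terminalVertex t ≠ b) : arcCost v b = 0 := by
  rw [arcCost, dif_pos hv]
  exact Finset.sum_eq_zero fun t _ => if_neg fun h => hb t h.symm

lemma arcCost_eq_zero_of_not_isThreshold (hn : n % 2 = 1) {v b : HalfSet n → Bool}
    (hv : ¬ IsThreshold v) (hb : ¬ IsThreshold b) : arcCost v b = 0 := by
  rw [arcCost, dif_neg hv]
  refine Finset.sum_eq_zero fun S _ => ?_
  rw [if_neg, if_neg, add_zero]
  · rintro rfl
    exact hb (isThreshold_downVertex hn v S)
  · rintro rfl
    exact hb (isThreshold_upVertex hn v S)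

lemma sum_arcCost_mul_of_isThreshold {v : HalfSet n → Bool} (hv : IsThreshold v)
    (f : (HalfSet n → Bool) → ℚ) :
    ∑ b, arcCost v b * f b =
      (2 * Fintype.card (HalfSet n) * Fintype.card (HalfSet n → Bool) + 1) *
        ∑ t, hv.choose t * f (terminalVertex t) := by
  simp only [arcCost, dif_pos hv, Finset.sum_mul, ite_mul, zero_mul]
  rw [Finset.sum_comm, Finset.mul_sum]
  refine Finset.sum_congr rfl fun t _ => ?_
  simp [mul_assoc]

lemma sum_arcCost_mul_of_not_isThreshold {v : HalfSet n → Bool} (hv : ¬ IsThreshold v)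
    (f : (HalfSet n → Bool) → ℚ) :
    ∑ b, arcCost v b * f b = ∑ S, (f (upVertex v S) + f (downVertex v S)) := by
  simp only [arcCost, dif_neg hv, Finset.sum_mul, add_mul, ite_mul, zero_mul, one_mul]
  rw [Finset.sum_comm]
  refine Finset.sum_congr rfl fun S _ => ?_
  simp [Finset.sum_add_distrib]

/-- The network whose vertices are all possible placements relative to the balanced
bipartitions of the terminals. -/
noncomputable def placementNetwork (hn : 3 ≤ n) : NetworkQ (n + 1) where
  V := HalfSet n → Bool
  cost u v := arcCost u v + arcCost v u
  cost_symm _ _ := add_comm _ _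
  cost_nonneg _ _ := add_nonneg (arcCost_nonneg _ _) (arcCost_nonneg _ _)
  term := terminalVertex
  term_inj := terminalVertex_injective hn

/-- The part containing the terminal `0` of the bipartition of the terminals encoded
by `T`. -/
def HalfSet.part (T : HalfSet n) : Finset (Fin (n + 1)) :=
  Finset.univ.filter fun t => T.side t = true

/-- A minimum separating bipartition for the part encoded by `T` places every vertex as
that vertex prescribes. -/
lemma IsMinSepBip.mem_placementNetwork (h3 : 3 ≤ n) (hn : n % 2 = 1) (T : HalfSet n)
    {A : Finset (HalfSet n → Bool)} (hA : (placementNetwork h3).IsMinSepBip T.part A)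
    (v : HalfSet n → Bool) : decide (v ∈ A) = v T := by
  have hterm : ∀ t, decide (terminalVertex t ∈ A) = T.side t := by
    intro t
    cases h : T.side t
    · exact decide_eq_false (hA.1.2 t (by simp [HalfSet.part, h]))
    · exact decide_eq_true (hA.1.1 t (by simp [HalfSet.part, h]))
  have hmaj : ∀ v : HalfSet n → Bool, (∀ t, terminalVertex t ≠ v) →
      0 < boolSign (v T) * (∑ b, arcCost v b * boolSign (decide (b ∈ A)) +
        ∑ b, arcCost b v * boolSign (decide (b ∈ A))) → decide (v ∈ A) = v T := by
    intro v hv hpos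
    rw [← Finset.sum_add_distrib] at hpos
    simp only [← add_mul] at hpos
    exact hA.mem_majority (placementNetwork h3) hv (v T) hpos
  have hthr : ∀ v : HalfSet n → Bool, IsThreshold v → decide (v ∈ A) = v T := by
    intro v hv
    by_cases hvt : ∃ t, terminalVertex t = v
    · obtain ⟨t, rfl⟩ := hvt
      exact hterm t
    push Not at hvt
    refine hmaj v hvt ?_
    rw [sum_arcCost_mul_of_isThreshold hv]
    simp only [hterm]
    have hvote := hv.choose_spec.2 T
    have hback : |∑ b, arcCost b v * boolSign (decide (b ∈ A))| ≤
        2 * Fintype.card (HalfSet n) * Fintype.card (HalfSet n → Bool) := by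
      refine (Finset.abs_sum_le_sum_abs _ _).trans
        ((Finset.sum_le_card_nsmul _ _ (2 * Fintype.card (HalfSet n) : ℚ) fun b _ => ?_).trans
          (by simp [mul_comm]))
      rw [abs_mul, abs_boolSign, mul_one, abs_of_nonneg (arcCost_nonneg b v)]
      by_cases hb : IsThreshold b
      · rw [arcCost_eq_zero_of_isThreshold hb hvt]
        positivity
      · exact arcCost_le hb v
    have hsigned : |boolSign (v T) * ∑ b, arcCost b v * boolSign (decide (b ∈ A))| ≤
        2 * Fintype.card (HalfSet n) * Fintype.card (HalfSet n → Bool) := by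
      rw [abs_mul, abs_boolSign, one_mul]
      exact hback
    have hlow := (abs_le.1 hsigned).1
    have hM : (0 : ℚ) ≤ 2 * Fintype.card (HalfSet n) * Fintype.card (HalfSet n → Bool) + 1 := by
      positivity
    have hprod := mul_le_mul_of_nonneg_left hvote hM
    rw [mul_add, mul_left_comm]
    linarith
  by_cases hv : IsThreshold v
  · exact hthr v hv
  by_cases hvt : ∃ t, terminalVertex t = v
  · obtain ⟨t, rfl⟩ := hvt
    exact hterm t
  push Not at hvt
  refine hmaj v hvt ?_
  have hback : ∑ b, arcCost b v * boolSign (decide (b ∈ A)) = 0 := by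
    refine Finset.sum_eq_zero fun b _ => ?_
    by_cases hb : IsThreshold b
    · rw [arcCost_eq_zero_of_isThreshold hb hvt, zero_mul]
    · rw [arcCost_eq_zero_of_not_isThreshold hn hb hv, zero_mul]
  rw [hback, sum_arcCost_mul_of_not_isThreshold hv]
  simp only [hthr _ (isThreshold_upVertex hn v _), hthr _ (isThreshold_downVertex hn v _),
    boolSign_upVertex_add_downVertex]
  have := boolSign_mul_self (v T)
  simp only [Finset.sum_ite_eq, Finset.mem_univ, if_true]
  linarith

end Construction

end NetworkQ

/-- For every `k ≡ 6 (mod 8)`, with `ℓ = C(k-1, ⌊(k-1)/2⌋)`, there is a `k`-terminal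
network with at least `C(ℓ, ℓ/2)` vertices in which every pair of distinct vertices is
separated by every minimum `S`-separating bipartition for some subset `S` of the
terminals; hence no two vertices can be identified without strictly increasing the
weight of some minimum terminal-separating cut. -/
theorem exists_incompressible_network (k : ℕ) (hk : 6 ≤ k) (hmod : k % 8 = 6) :
    ∃ N : NetworkQ k,
      ((k - 1).choose ((k - 1) / 2)).choose ((k - 1).choose ((k - 1) / 2) / 2) ≤
        Fintype.card N.V ∧
      ∀ u v : N.V, u ≠ v → ∃ S : Finset (Fin k),
        ∀ A : Finset N.V, N.IsMinSepBip S A → (u ∈ A ↔ v ∉ A) := by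
  obtain ⟨n, rfl⟩ : ∃ n, k = n + 1 := ⟨k - 1, by omega⟩
  have h3 : 3 ≤ n := by omega
  have hn : n % 2 = 1 := by omega
  refine ⟨NetworkQ.placementNetwork h3, ?_, fun u v huv => ?_⟩
  · have hcard : Fintype.card (NetworkQ.placementNetwork h3).V = 2 ^ n.choose (n / 2) := by
      change Fintype.card (NetworkQ.HalfSet n → Bool) = _
      rw [Fintype.card_fun, Fintype.card_bool, Fintype.card_finset_len, Fintype.card_fin]
    rw [hcard, Nat.add_sub_cancel]
    exact Nat.choose_le_two_pow _ _
  · obtain ⟨T, hT⟩ := Function.ne_iff.1 huv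
    refine ⟨T.part, fun A hA => ?_⟩
    have hu := NetworkQ.IsMinSepBip.mem_placementNetwork h3 hn T hA u
    have hv := NetworkQ.IsMinSepBip.mem_placementNetwork h3 hn T hA v
    have hne : ¬ (u ∈ A ↔ v ∈ A) := fun h => hT (hu.symm.trans ((decide_eq_decide.2 h).trans hv))
    tauto
end

section
/- Let r be a positive integer with r ≡ 2 (mod 4), let ℓ = C(2r+1, r) (which is even), and let α be a rational number with α > r²·ℓ·C(ℓ, ℓ/2). In the three-layer network G(r, α) with terminal set Q = Q0 ∪ {x}, let S ⊆ Q be important (x ∈ S and |S| = r+1) and set S0 = S ∖ {x}. Then for every Z ⊆ U with |Z| = ℓ/2 and every minimum S-separating bipartition (A, V∖A) of G(r, α) (with S ⊆ A and Q∖S ⊆ V∖A), the vertex w_Z lies in A if and only if u_{S0} ∈ Z. -/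
namespace DoubleExp

/-- `ℓ = C(2r+1, r)`. -/
abbrev ell (r : ℕ) : ℕ := (2 * r + 1).choose r

/-- Index set of the middle layer `U`: subsets `S ⊆ Q0` of size `r`. -/
abbrev UIdx (r : ℕ) := {S : Finset (Fin (2 * r + 1)) // S.card = r}

/-- Index set of the last layer `W`: subsets `Z ⊆ U` of size `ℓ/2`. -/
abbrev WIdx (r : ℕ) := {Z : Finset (UIdx r) // Z.card = ell r / 2}

/-- The vertex set of `G(r, α)`: `Q0 ⊎ {x} ⊎ U ⊎ W`. -/
abbrev Vtx (r : ℕ) := (Fin (2 * r + 1) ⊕ Unit) ⊕ (UIdx r ⊕ WIdx r)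

/-- The terminal `q ∈ Q0`. -/
def vq (r : ℕ) (i : Fin (2 * r + 1)) : Vtx r := Sum.inl (Sum.inl i)

/-- The extra terminal `x`. -/
def vx (r : ℕ) : Vtx r := Sum.inl (Sum.inr ())

/-- The middle-layer vertex `u_S`. -/
def vu (r : ℕ) (S : UIdx r) : Vtx r := Sum.inr (Sum.inl S)

/-- The last-layer vertex `w_Z`. -/
def vw (r : ℕ) (Z : WIdx r) : Vtx r := Sum.inr (Sum.inr Z)

/-- The symmetric edge cost function of `G(r, α)`: `u_S q` costs
`(1 + 1/r + 1/r²)·α` if `q ∈ S` and `α` otherwise; `u_S w_Z` costs `1` if `u_S ∈ Z`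
and `0` otherwise; `x w_Z` costs `ℓ/2 − 1`; all other pairs are non-adjacent (cost `0`). -/
def cost (r : ℕ) (α : ℚ) : Vtx r → Vtx r → ℚ
  | Sum.inr (Sum.inl S), Sum.inl (Sum.inl q) =>
      if q ∈ S.1 then (1 + 1 / (r : ℚ) + 1 / (r : ℚ) ^ 2) * α else α
  | Sum.inl (Sum.inl q), Sum.inr (Sum.inl S) =>
      if q ∈ S.1 then (1 + 1 / (r : ℚ) + 1 / (r : ℚ) ^ 2) * α else α
  | Sum.inr (Sum.inl S), Sum.inr (Sum.inr Z) => if S ∈ Z.1 then 1 else 0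
  | Sum.inr (Sum.inr Z), Sum.inr (Sum.inl S) => if S ∈ Z.1 then 1 else 0
  | Sum.inl (Sum.inr _), Sum.inr (Sum.inr _) => (ell r : ℚ) / 2 - 1
  | Sum.inr (Sum.inr _), Sum.inl (Sum.inr _) => (ell r : ℚ) / 2 - 1
  | _, _ => 0

/-- The terminal set `Q = Q0 ∪ {x}`. -/
def Qset (r : ℕ) : Finset (Vtx r) :=
  (Finset.univ.image (vq r)) ∪ {vx r}

/-- The total cost of the edges crossing the bipartition `(A, V ∖ A)`. -/
def cutWeight (r : ℕ) (α : ℚ) (A : Finset (Vtx r)) : ℚ :=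
  ∑ a ∈ A, ∑ b ∈ Aᶜ, cost r α a b

/-- `(A, V ∖ A)` is an `S`-separating bipartition: `S ⊆ A` and `Q ∖ S ⊆ V ∖ A`. -/
def SepBip (r : ℕ) (S : Finset (Vtx r)) (A : Finset (Vtx r)) : Prop :=
  S ⊆ A ∧ ∀ t ∈ Qset r \ S, t ∉ A

/-- `(A, V ∖ A)` is a minimum `S`-separating bipartition of `G(r, α)`. -/
def IsMinSepBip (r : ℕ) (α : ℚ) (S : Finset (Vtx r)) (A : Finset (Vtx r)) : Prop :=
  SepBip r S A ∧ ∀ B : Finset (Vtx r), SepBip r S B → cutWeight r α A ≤ cutWeight r α B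

end DoubleExp

section CutFlip

variable {V : Type*} [Fintype V] [DecidableEq V] {c : V → V → ℚ}

/-- The change of the cut weight when `v` is moved into `B`. -/
theorem sum_cut_insert_sub (hsymm : ∀ a b, c a b = c b a) (hdiag : ∀ a, c a a = 0)
    {B : Finset V} {v : V} (hv : v ∉ B) :
    ∑ a ∈ insert v B, ∑ b ∈ (insert v B)ᶜ, c a b - ∑ a ∈ B, ∑ b ∈ Bᶜ, c a b
      = -∑ b, c v b * (if b ∈ B then 1 else -1) := by
  have hinsert (a : V) : ∑ b ∈ (insert v B)ᶜ, c a b = ∑ b ∈ Bᶜ, c a b - c v a := by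
    rw [Finset.compl_insert, Finset.sum_erase_eq_sub (Finset.mem_compl.2 hv), hsymm a v]
  have hin : ∑ b ∈ B, c v b * (if b ∈ B then 1 else -1) = ∑ b ∈ B, c v b :=
    Finset.sum_congr rfl fun b hb => by simp [hb]
  have hout : ∑ b ∈ Bᶜ, c v b * (if b ∈ B then 1 else -1) = -∑ b ∈ Bᶜ, c v b := by
    rw [← Finset.sum_neg_distrib]
    exact Finset.sum_congr rfl fun b hb => by simp [Finset.mem_compl.1 hb]
  rw [Finset.sum_insert hv, ← Finset.sum_add_sum_compl B, hin, hout]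
  simp only [hinsert, Finset.sum_sub_distrib, hdiag]
  ring

end CutFlip

namespace DoubleExp

theorem cost_symm (r : ℕ) (α : ℚ) (a b : Vtx r) : cost r α a b = cost r α b a := by
  rcases a with (a | a) | (a | a) <;> rcases b with (b | b) | (b | b) <;> rfl

theorem cost_self (r : ℕ) (α : ℚ) (a : Vtx r) : cost r α a a = 0 := by
  rcases a with (a | a) | (a | a) <;> rfl

/-- The total cost of the edges from `v` to `A` minus that of the edges from `v` to `V ∖ A`. -/
def pull (r : ℕ) (α : ℚ) (A : Finset (Vtx r)) (v : Vtx r) : ℚ :=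
  ∑ b, cost r α v b * (if b ∈ A then 1 else -1)

section Minimum

variable {r : ℕ} {α : ℚ} {S A : Finset (Vtx r)} {v : Vtx r}

theorem notMem_Qset_inr (y : UIdx r ⊕ WIdx r) : (Sum.inr y : Vtx r) ∉ Qset r := by
  simp [Qset, vq, vx]

theorem IsMinSepBip.mem_of_pull_pos (hA : IsMinSepBip r α S A) (hv : v ∉ Qset r)
    (h : 0 < pull r α A v) : v ∈ A := by
  by_contra hvA
  have hflip := sum_cut_insert_sub (cost_symm r α) (cost_self r α) hvA
  have hmin := hA.2 (insert v A) ⟨hA.1.1.trans (Finset.subset_insert _ _), fun t ht htA => by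
    rcases Finset.mem_insert.1 htA with rfl | h'
    · exact hv (Finset.mem_sdiff.1 ht).1
    · exact hA.1.2 t ht h'⟩
  unfold cutWeight at hmin
  unfold pull at h
  linarith

theorem IsMinSepBip.notMem_of_pull_neg (hA : IsMinSepBip r α S A) (hSQ : S ⊆ Qset r)
    (hv : v ∉ Qset r) (h : pull r α A v < 0) : v ∉ A := by
  intro hvA
  have hflip := sum_cut_insert_sub (cost_symm r α) (cost_self r α) (Finset.notMem_erase v A)
  rw [Finset.insert_erase hvA] at hflip
  have hmin := hA.2 (A.erase v) ⟨fun t ht => Finset.mem_erase.2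
    ⟨fun htv => hv (htv ▸ hSQ ht), hA.1.1 ht⟩,
    fun t ht htA => hA.1.2 t ht (Finset.mem_of_mem_erase htA)⟩
  have hpull : ∑ b, cost r α v b * (if b ∈ A.erase v then 1 else -1) = pull r α A v := by
    refine Finset.sum_congr rfl fun b _ => ?_
    rcases eq_or_ne b v with rfl | hb
    · simp [cost_self]
    · simp [hb]
  unfold cutWeight at hmin
  linarith

end Minimum

theorem pull_vu (r : ℕ) (α : ℚ) (A : Finset (Vtx r)) (T : UIdx r) :
    pull r α A (vu r T) =
      ∑ q, (if q ∈ T.1 then (1 + 1 / (r : ℚ) + 1 / (r : ℚ) ^ 2) * α else α) *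
        (if vq r q ∈ A then 1 else -1) +
      ∑ Z : WIdx r, (if T ∈ Z.1 then 1 else 0) * (if vw r Z ∈ A then 1 else -1) := by
  simp only [pull, cost, vu, vq, vw, Fintype.sum_sum_type, zero_mul, Finset.sum_const_zero,
    zero_add, add_zero]
  rfl

theorem pull_vw (r : ℕ) (α : ℚ) (A : Finset (Vtx r)) (Z : WIdx r) :
    pull r α A (vw r Z) =
      ((ell r : ℚ) / 2 - 1) * (if vx r ∈ A then 1 else -1) +
      ∑ T : UIdx r, (if T ∈ Z.1 then 1 else 0) * (if vu r T ∈ A then 1 else -1) := by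
  simp only [pull, cost, vu, vx, vw, Fintype.sum_sum_type, zero_mul, Finset.sum_const_zero,
    zero_add, add_zero, Finset.univ_unique, Finset.sum_singleton, PUnit.default_eq_unit]
  rfl

theorem card_WIdx (r : ℕ) : Fintype.card (WIdx r) = (ell r).choose (ell r / 2) := by
  simp [WIdx, UIdx, ell]

theorem abs_sum_W_le (r : ℕ) (A : Finset (Vtx r)) (T : UIdx r) :
    |∑ Z : WIdx r, (if T ∈ Z.1 then (1 : ℚ) else 0) * (if vw r Z ∈ A then 1 else -1)|
      ≤ (ell r).choose (ell r / 2) := by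
  refine (Finset.abs_sum_le_sum_abs _ _).trans ?_
  calc _ ≤ ∑ _Z : WIdx r, (1 : ℚ) := Finset.sum_le_sum fun Z _ => by split_ifs <;> simp
    _ = _ := by rw [← card_WIdx]; simp

/-- With `k = |T ∩ S0|`, the terminals pull `u_T` with strength `α ((β - 1) (2k - r) - 1)`,
where `β α` is the cost of the heavy edges. -/
theorem sum_terminal_pull (r : ℕ) (α β : ℚ) (T S0 : Finset (Fin (2 * r + 1)))
    (hT : T.card = r) (hS0 : S0.card = r) :
    ∑ q, (if q ∈ T then β * α else α) * (if q ∈ S0 then 1 else -1)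
      = α * ((β - 1) * (2 * (T ∩ S0).card - r) - 1) := by
  have hpoint (q : Fin (2 * r + 1)) :
      (if q ∈ T then β * α else α) * (if q ∈ S0 then 1 else -1)
        = 2 * ((β - 1) * α) * (if q ∈ T ∩ S0 then 1 else 0)
          - (β - 1) * α * (if q ∈ T then 1 else 0)
          + 2 * α * (if q ∈ S0 then 1 else 0) - α := by
    by_cases h1 : q ∈ T <;> by_cases h2 : q ∈ S0 <;> simp [h1, h2] <;> ring
  simp only [hpoint, Finset.sum_sub_distrib, Finset.sum_add_distrib, ← Finset.mul_sum,
    Finset.sum_boole, Finset.filter_univ_mem, hT, hS0]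
  simp
  ring

theorem lt_div_of_sq_mul_mul_lt {r l C α : ℚ} (hr : 1 ≤ r) (hl : 1 ≤ l) (hC : 0 ≤ C)
    (h : r ^ 2 * l * C < α) : C < α / r := by
  have hrl : 1 ≤ r * l := one_le_mul_of_one_le_of_one_le hr hl
  have hrC : 0 ≤ r * C := by positivity
  rw [lt_div_iff₀ (by positivity)]
  nlinarith [mul_le_mul_of_nonneg_right hrl hrC]

theorem strength_le {r k : ℚ} (hr : 1 ≤ r) (hk : k + 1 ≤ r) :
    (1 + 1 / r + 1 / r ^ 2 - 1) * (2 * k - r) - 1 ≤ -(1 / r) := by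
  have hβ : 0 ≤ 1 + 1 / r + 1 / r ^ 2 - 1 := by
    have : 0 ≤ 1 / r + 1 / r ^ 2 := by positivity
    linarith
  calc _ ≤ (1 + 1 / r + 1 / r ^ 2 - 1) * (r - 2) - 1 := by
        linarith [mul_le_mul_of_nonneg_left (by linarith : 2 * k - r ≤ r - 2) hβ]
    _ = -(1 / r) - 2 / r ^ 2 := by field_simp; ring
    _ ≤ _ := by linarith [show 0 ≤ 2 / r ^ 2 by positivity]

theorem vu_mem_iff (r : ℕ) (hr : 0 < r) (α : ℚ)
    (hα : (r : ℚ) ^ 2 * (ell r : ℚ) * ((ell r).choose (ell r / 2) : ℚ) < α)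
    (S : Finset (Vtx r)) (hSQ : S ⊆ Qset r)
    (S0 : Finset (Fin (2 * r + 1))) (hS0card : S0.card = r)
    (A : Finset (Vtx r)) (hA : IsMinSepBip r α S A) (hq : ∀ q, vq r q ∈ A ↔ q ∈ S0)
    (T : UIdx r) : vu r T ∈ A ↔ T = ⟨S0, hS0card⟩ := by
  have hpull := pull_vu r α A T
  simp only [hq] at hpull
  rw [sum_terminal_pull r α _ T.1 S0 T.2 hS0card] at hpull
  have hW := abs_le.1 (abs_sum_W_le r A T)
  have hr1 : (1 : ℚ) ≤ r := by exact_mod_cast hr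
  have hell : (1 : ℚ) ≤ ell r := by
    exact_mod_cast Nat.succ_le_of_lt (Nat.choose_pos (by omega : r ≤ 2 * r + 1))
  have hgap := lt_div_of_sq_mul_mul_lt hr1 hell (Nat.cast_nonneg _) hα
  have hα0 : 0 < α := lt_of_le_of_lt (by positivity) hα
  generalize (((ell r).choose (ell r / 2) : ℕ) : ℚ) = C at hgap hW
  generalize ∑ Z : WIdx r, (if T ∈ Z.1 then (1 : ℚ) else 0) * (if vw r Z ∈ A then 1 else -1) = w
    at hpull hW
  constructor
  · intro hmem
    by_contra hne
    refine hA.notMem_of_pull_neg hSQ (notMem_Qset_inr _) ?_ hmem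
    have hk : (T.1 ∩ S0).card + 1 ≤ r := by
      by_contra hlt
      have h1 : T.1 ∩ S0 = T.1 := Finset.eq_of_subset_of_card_le Finset.inter_subset_left
        (by rw [T.2]; omega)
      have h2 : T.1 ∩ S0 = S0 := Finset.eq_of_subset_of_card_le Finset.inter_subset_right
        (by omega)
      exact hne (Subtype.ext (h1.symm.trans h2))
    have hstrength := mul_le_mul_of_nonneg_left
      (strength_le hr1 (k := (T.1 ∩ S0).card) (by exact_mod_cast hk)) hα0.le
    have heq : α * -(1 / (r : ℚ)) = -(α / r) := by ring
    exact hpull.trans_lt (by linarith [hW.2])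
  · rintro rfl
    refine hA.mem_of_pull_pos (notMem_Qset_inr _) ?_
    have hstrength : α * ((1 + 1 / (r : ℚ) + 1 / (r : ℚ) ^ 2 - 1) * (2 * r - r) - 1) = α / r := by
      field_simp
      ring
    rw [Finset.inter_self, hS0card, hstrength] at hpull
    exact lt_of_lt_of_eq (by linarith [hW.1]) hpull.symm

end DoubleExp

open DoubleExp in
/-- For an important set `S ⊆ Q` (with `S0 = S \ {x}`) and `α > r²·ℓ·C(ℓ, ℓ/2)`,
a vertex `w_Z` lies on the `S`-side of every minimum `S`-separating bipartition of
`G(r, α)` if and only if `u_{S0} ∈ Z`. -/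
theorem wZ_side_iff (r : ℕ) (hr : 0 < r) (hmod : r % 4 = 2) (α : ℚ)
    (hα : (r : ℚ) ^ 2 * (ell r : ℚ) * ((ell r).choose (ell r / 2) : ℚ) < α)
    (S : Finset (Vtx r)) (hSQ : S ⊆ Qset r) (hxS : vx r ∈ S) (hScard : S.card = r + 1)
    (S0 : Finset (Fin (2 * r + 1))) (hS0 : S0.image (vq r) = S.erase (vx r))
    (hS0card : S0.card = r)
    (Z : WIdx r) (A : Finset (Vtx r)) (hA : IsMinSepBip r α S A) :
    vw r Z ∈ A ↔ (⟨S0, hS0card⟩ : UIdx r) ∈ Z.1 := by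
  have hq (q : Fin (2 * r + 1)) : vq r q ∈ A ↔ q ∈ S0 := by
    have himage : vq r q ∈ S0.image (vq r) ↔ q ∈ S0 := by simp [vq]
    rw [← himage, hS0]
    refine ⟨fun h => ?_, fun h => hA.1.1 (Finset.mem_of_mem_erase h)⟩
    refine Finset.mem_erase.2 ⟨by simp [vq, vx], ?_⟩
    by_contra hS
    exact hA.1.2 _ (Finset.mem_sdiff.2 ⟨by simp [Qset], hS⟩) h
  have hu := vu_mem_iff r hr α hα S hSQ S0 hS0card A hA hq
  have hpull := pull_vw r α A Z
  have hpoint (T : UIdx r) :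
      (if T ∈ Z.1 then (1 : ℚ) else 0) * (if vu r T ∈ A then 1 else -1)
        = 2 * (if (⟨S0, hS0card⟩ : UIdx r) = T then if T ∈ Z.1 then 1 else 0 else 0)
          - (if T ∈ Z.1 then 1 else 0) := by
    simp only [hu, eq_comm (a := T)]
    split_ifs <;> norm_num
  simp only [hpoint, Finset.sum_sub_distrib, ← Finset.mul_sum, Finset.sum_ite_eq,
    Finset.mem_univ, if_true, Finset.sum_boole, Finset.filter_univ_mem, Z.2,
    hA.1.1 hxS] at hpull
  have hlow : (ell r : ℚ) ≤ 2 * ((ell r / 2 : ℕ) : ℚ) + 1 := by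
    exact_mod_cast (by omega : ell r ≤ 2 * (ell r / 2) + 1)
  have hhigh : 2 * ((ell r / 2 : ℕ) : ℚ) ≤ ell r := by
    exact_mod_cast (by omega : 2 * (ell r / 2) ≤ ell r)
  by_cases hZ : (⟨S0, hS0card⟩ : UIdx r) ∈ Z.1
  · refine iff_of_true (hA.mem_of_pull_pos (notMem_Qset_inr _) ?_) hZ
    rw [if_pos hZ] at hpull
    exact hpull ▸ by linarith
  · refine iff_of_false (hA.notMem_of_pull_neg hSQ (notMem_Qset_inr _) ?_) hZ
    rw [if_neg hZ] at hpull
    exact hpull ▸ by linarith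
end
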